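/- Let f be a piecewise contracting interval map, injective on each contraction piece, with D ⊂ X̃. Let x ∈ X̃ and i, j ∈ {1,...,N-1} with c_i ∈ Δ_lr(d_j^+) ∩ Δ_lr(x) and c_j ∈ Δ_lr(d_i^+) ∩ Δ_lr(x). Then ω(x) = ω(d_i^+) = ω(d_j^+). -/

import Mathlib

open Filter Topology Set

/-- A piecewise contracting interval map on `X = [c 0, c N]` with contraction pieces
`X_i` delimited by the points `c 0 < c 1 < … < c N`, contraction rate `lam ∈ (0,1)`,
and `fe i` the (unique) continuous `lam`-Lipschitz extension of `f` restricted to the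
`i`-th piece to its closure `[c (i-1), c i]`. The pieces are
`X_1 = [c 0, c 1)`, `X_i = (c (i-1), c i)` for `1 < i < N`, `X_N = (c (N-1), c N]`. -/
structure PCIM where
  N : ℕ
  hN : 2 ≤ N
  c : ℕ → ℝ
  lam : ℝ
  f : ℝ → ℝ
  fe : ℕ → ℝ → ℝ
  hc : StrictMonoOn c (Set.Iic N)
  hlam : lam ∈ Set.Ioo (0 : ℝ) 1
  hmap : Set.MapsTo f (Set.Icc (c 0) (c N)) (Set.Icc (c 0) (c N))
  hfe_lip : ∀ i, 1 ≤ i → i ≤ N →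
    ∀ x ∈ Set.Icc (c (i - 1)) (c i), ∀ y ∈ Set.Icc (c (i - 1)) (c i),
      |fe i x - fe i y| ≤ lam * |x - y|
  hfe_eq : ∀ i, 1 ≤ i → i ≤ N → ∀ x ∈ Set.Ioo (c (i - 1)) (c i), fe i x = f x
  hfe_left : fe 1 (c 0) = f (c 0)
  hfe_right : fe N (c N) = f (c N)

namespace PCIM

variable (P : PCIM)

/-- The phase space `X = [c 0, c N]`. -/
def X : Set ℝ := Set.Icc (P.c 0) (P.c P.N)

/-- The `i`-th contraction piece (`1 ≤ i ≤ N`). -/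
def piece (i : ℕ) : Set ℝ :=
  Set.Ioo (P.c (i - 1)) (P.c i)
    ∪ (if i = 1 then {P.c 0} else (∅ : Set ℝ))
    ∪ (if i = P.N then {P.c P.N} else (∅ : Set ℝ))

/-- `Δ`, the set of interior boundary points of the pieces. -/
def Δ : Set ℝ := {y | ∃ i, 1 ≤ i ∧ i < P.N ∧ y = P.c i}

/-- `X̃ = ⋂ n, f⁻ⁿ(X \ Δ)`: points whose whole forward orbit stays in `X` and avoids `Δ`. -/
def Xt : Set ℝ := {x | ∀ n : ℕ, P.f^[n] x ∈ P.X \ P.Δ}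

/-- Forward orbit of `x`. -/
def orbit (x : ℝ) : Set ℝ := Set.range fun n : ℕ => P.f^[n] x

/-- The ω-limit set of `x`: limits of subsequences of the forward orbit. -/
def omega (x : ℝ) : Set ℝ :=
  {y | ∃ φ : ℕ → ℕ, StrictMono φ ∧
    Filter.Tendsto (fun n => P.f^[φ n] x) Filter.atTop (nhds y)}

/-- `d_i^- = f_i (c_i)`, the left lateral limit of `f` at `c i`. -/
def dminus (i : ℕ) : ℝ := P.fe i (P.c i)

/-- `d_i^+ = f_{i+1} (c_i)`, the right lateral limit of `f` at `c i`. -/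
def dplus (i : ℕ) : ℝ := P.fe (i + 1) (P.c i)

/-- `D⁻ = {d_1^-, …, d_{N-1}^-}`. -/
def Dminus : Set ℝ := {y | ∃ i, 1 ≤ i ∧ i < P.N ∧ y = P.dminus i}

/-- `D⁺ = {d_1^+, …, d_{N-1}^+}`. -/
def Dplus : Set ℝ := {y | ∃ i, 1 ≤ i ∧ i < P.N ∧ y = P.dplus i}

/-- `D`, the set of all one-sided limits of `f` at endpoints of the pieces. -/
def D : Set ℝ := P.Dminus ∪ P.Dplus ∪ {P.fe 1 (P.c 0), P.fe P.N (P.c P.N)}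

/-- `A` is pseudo-invariant: for every `x ∈ A` at least one one-sided limit of `f`
at `x` (i.e. some `fe i x` with `x` in the closure of the `i`-th piece) belongs to `A`. -/
def PseudoInvariant (A : Set ℝ) : Prop :=
  ∀ x ∈ A, ∃ i, 1 ≤ i ∧ i ≤ P.N ∧ x ∈ Set.Icc (P.c (i - 1)) (P.c i) ∧ P.fe i x ∈ A

/-- `F_i(A) = closure (f (A ∩ X_i))`. -/
def Fmap (i : ℕ) (A : Set ℝ) : Set ℝ := closure (P.f '' (A ∩ P.piece i))

/-- For a word `w = [i_1, …, i_n]`, the set `F_{i_n} ∘ … ∘ F_{i_1} (X)`. -/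
def atomOf (w : List ℕ) : Set ℝ := w.foldl (fun S i => P.Fmap i S) P.X

/-- `A` is an atom of generation `n`. -/
def IsAtomGen (n : ℕ) (A : Set ℝ) : Prop :=
  ∃ w : List ℕ, w.length = n ∧ (∀ i ∈ w, 1 ≤ i ∧ i ≤ P.N) ∧
    A = P.atomOf w ∧ A.Nonempty

/-- `Lam n` is `Λ_{n+1}` of the paper: `Λ_1 = closure (f(X \ Δ))`,
`Λ_{n+1} = closure (f(Λ_n \ Δ))`. -/
def Lam (P : PCIM) : ℕ → Set ℝ
  | 0 => closure (P.f '' (P.X \ P.Δ))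
  | n + 1 => closure (P.f '' (P.Lam n \ P.Δ))

/-- The attractor `Λ = ⋂_{n ≥ 1} Λ_n`. -/
def attractor : Set ℝ := ⋂ n : ℕ, P.Lam n

/-- `c i ∈ Δ_lr(x)`: the boundary point `c i` is left-right recurrently visited by the
orbit of `x`. -/
def lrVisited (x : ℝ) (i : ℕ) : Prop :=
  1 ≤ i ∧ i < P.N ∧
  ∃ l r : ℕ → ℕ, StrictMono l ∧ StrictMono r ∧
    (∀ j, P.f^[l j] x ∈ P.piece i) ∧ (∀ j, P.f^[r j] x ∈ P.piece (i + 1)) ∧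
    Filter.Tendsto (fun j => P.f^[l j] x) Filter.atTop (nhds (P.c i)) ∧
    Filter.Tendsto (fun j => P.f^[r j] x) Filter.atTop (nhds (P.c i))

/-- `c i ∈ Δ_lr`: `c i` is left-right recurrently visited by the orbit of some point
of `X̃`. -/
def inΔlr (i : ℕ) : Prop := ∃ x ∈ P.Xt, P.lrVisited x i

/-- The set `Δ_lr ⊆ Δ`. -/
def ΔlrSet : Set ℝ := {y | ∃ i, P.inΔlr i ∧ y = P.c i}

/-- The relation `∼⁺` on `Δ_lr`: `c_i ∼⁺ c_j` iff `c_i = c_j` or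
(`c_i ∈ Δ_lr(d_j^+)` and `c_j ∈ Δ_lr(d_i^+)`). -/
def simP (a b : ℝ) : Prop :=
  a = b ∨ ∃ i j, P.inΔlr i ∧ P.inΔlr j ∧ a = P.c i ∧ b = P.c j ∧
    P.lrVisited (P.dplus j) i ∧ P.lrVisited (P.dplus i) j

/-- The relation `≼⁺` (on representatives): `[c_i] ≼⁺ [c_j]` iff `[c_i] = [c_j]` or
`c_i ∈ Δ_lr(d_j^+)`. -/
def preP (a b : ℝ) : Prop :=
  P.simP a b ∨ ∃ i j, P.inΔlr i ∧ P.inΔlr j ∧ a = P.c i ∧ b = P.c j ∧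
    P.lrVisited (P.dplus j) i

/-- `[c i]` is a minimal class for the partial order `≼⁺`. -/
def MinimalClass (i : ℕ) : Prop :=
  P.inΔlr i ∧ ∀ j, P.inΔlr j → P.preP (P.c j) (P.c i) → P.simP (P.c j) (P.c i)

/-- `f` is injective on each contraction piece. -/
def InjPieces : Prop := ∀ i, 1 ≤ i → i ≤ P.N → Set.InjOn P.f (P.piece i)

/-- `f` is (strictly) increasing on each contraction piece. -/
def IncrPieces : Prop := ∀ i, 1 ≤ i → i ≤ P.N → StrictMonoOn P.f (P.piece i)

/-- `x` is a periodic point of `f`. -/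
def IsPeriodic (x : ℝ) : Prop := ∃ p : ℕ, 1 ≤ p ∧ P.f^[p] x = x

/-- `η` is the itinerary of `x`: `f^[n] x ∈ X_{η n}` for all `n`. -/
def IsItinerary (x : ℝ) (η : ℕ → ℕ) : Prop :=
  ∀ n, 1 ≤ η n ∧ η n ≤ P.N ∧ P.f^[n] x ∈ P.piece (η n)

end PCIM

/-- The word of length `n` of the sequence `η` starting at position `t`. -/
def wordAt (η : ℕ → ℕ) (t n : ℕ) : List ℕ := (List.range n).map fun m => η (t + m)

/-- The complexity function of the sequence `η`: the number of distinct words of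
length `n` occurring in `η`. -/
noncomputable def complexity (η : ℕ → ℕ) (n : ℕ) : ℕ := Set.ncard {w : List ℕ | ∃ t, w = wordAt η t n}

theorem MonotoneOn.Icc_of_Ioo {a b : ℝ} {g : ℝ → ℝ} (hab : a < b)
    (hg : MonotoneOn g (Ioo a b)) (hc : ContinuousOn g (Icc a b)) : MonotoneOn g (Icc a b) := by
  have ha : MonotoneOn g (insert a (Ioo a b)) := by
    refine hg.insert_of_continuousWithinAt (mem_closure_iff_clusterPt.1 ?_)
      ((hc a (left_mem_Icc.2 hab.le)).mono Ioo_subset_Icc_self)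
    rw [closure_Ioo hab.ne]
    exact left_mem_Icc.2 hab.le
  rw [Ioo_insert_left hab] at ha
  have hb : MonotoneOn g (insert b (Ico a b)) := by
    refine ha.insert_of_continuousWithinAt (mem_closure_iff_clusterPt.1 ?_)
      ((hc b (right_mem_Icc.2 hab.le)).mono Ico_subset_Icc_self)
    rw [closure_Ico hab.ne]
    exact right_mem_Icc.2 hab.le
  rwa [Ico_insert_right hab.le] at hb

namespace PCIM

variable (P : PCIM)

theorem c_mono {m n : ℕ} (hmn : m ≤ n) (hn : n ≤ P.N) : P.c m ≤ P.c n :=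
  P.hc.monotoneOn (mem_Iic.2 (hmn.trans hn)) (mem_Iic.2 hn) hmn

theorem c_lt {m n : ℕ} (hmn : m < n) (hn : n ≤ P.N) : P.c m < P.c n :=
  P.hc (mem_Iic.2 (hmn.le.trans hn)) (mem_Iic.2 hn) hmn

theorem Icc_subset_X {k : ℕ} (hk : k ≤ P.N) : Icc (P.c (k - 1)) (P.c k) ⊆ P.X :=
  Icc_subset_Icc (P.c_mono (Nat.zero_le _) (by omega)) (P.c_mono hk le_rfl)

theorem piece_subset_Icc {k : ℕ} (h1 : 1 ≤ k) (hk : k ≤ P.N) :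
    P.piece k ⊆ Icc (P.c (k - 1)) (P.c k) := by
  have hlt : P.c (k - 1) ≤ P.c k := P.c_mono (by omega) hk
  rintro y ((hy | hy) | hy)
  · exact Ioo_subset_Icc_self hy
  · split_ifs at hy with h
    · subst h
      rw [mem_singleton_iff.1 hy]
      exact left_mem_Icc.2 hlt
    · exact hy.elim
  · split_ifs at hy with h
    · rw [mem_singleton_iff.1 hy, ← h]
      exact right_mem_Icc.2 hlt
    · exact hy.elim

theorem notMem_Δ_of_mem_Ioo {k : ℕ} (hk : k ≤ P.N) {y : ℝ}
    (hy : y ∈ Ioo (P.c (k - 1)) (P.c k)) : y ∉ P.Δ := by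
  rintro ⟨m, _, hmN, rfl⟩
  rcases le_or_gt k m with h | h
  · exact absurd (P.c_mono h hmN.le) (not_le.2 hy.2)
  · exact absurd (P.c_mono (m := m) (n := k - 1) (by omega) (by omega)) (not_le.2 hy.1)

theorem exists_mem_Icc {y : ℝ} (hy : y ∈ P.X) :
    ∃ k, 1 ≤ k ∧ k ≤ P.N ∧ y ∈ Icc (P.c (k - 1)) (P.c k) := by
  classical
  have hex : ∃ k, 1 ≤ k ∧ y ≤ P.c k := ⟨P.N, by have := P.hN; omega, hy.2⟩
  obtain ⟨h1, h2⟩ := Nat.find_spec hex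
  refine ⟨Nat.find hex, h1, Nat.find_min' hex ⟨by have := P.hN; omega, hy.2⟩, ?_, h2⟩
  by_contra! hlt
  by_cases h : Nat.find hex = 1
  · rw [h] at hlt
    exact absurd hy.1 (not_le.2 hlt)
  · exact Nat.find_min hex (m := Nat.find hex - 1) (by omega) ⟨by omega, hlt.le⟩

/-- Off `Δ`, the map `f` coincides with the extension of each piece whose closure contains
the point. -/
theorem f_eq_fe {k : ℕ} (h1 : 1 ≤ k) (hk : k ≤ P.N) {y : ℝ} (hyΔ : y ∉ P.Δ)
    (hy : y ∈ Icc (P.c (k - 1)) (P.c k)) : P.f y = P.fe k y := by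
  rcases hy.1.eq_or_lt with h | hl
  · by_cases hk1 : k = 1
    · subst hk1
      rw [← h]
      exact P.hfe_left.symm
    · exact absurd ⟨k - 1, by omega, by omega, h.symm⟩ hyΔ
  rcases hy.2.eq_or_lt with h | hr
  · by_cases hkN : k = P.N
    · subst hkN
      rw [h]
      exact P.hfe_right.symm
    · exact absurd ⟨k, h1, by omega, h⟩ hyΔ
  exact (P.hfe_eq k h1 hk y ⟨hl, hr⟩).symm

theorem Xt_sub {y : ℝ} (hy : y ∈ P.Xt) : y ∈ P.X \ P.Δ := hy 0

theorem iterate_mem_Xt {y : ℝ} (hy : y ∈ P.Xt) (n : ℕ) : P.f^[n] y ∈ P.Xt := fun m => by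
  rw [← Function.iterate_add_apply]
  exact hy (m + n)

theorem f_continuous_off_Δ {y : ℝ} (hy : y ∈ P.X \ P.Δ) {ε : ℝ} (hε : 0 < ε) :
    ∃ δ > 0, ∀ z ∈ P.X \ P.Δ, |z - y| < δ → |P.f z - P.f y| < ε := by
  obtain ⟨k, h1, hk, hyk⟩ := P.exists_mem_Icc hy.1
  have hl : ∃ δ > 0, ∀ z ∈ P.X, |z - y| < δ → P.c (k - 1) ≤ z := by
    by_cases hk1 : k = 1
    · subst hk1
      exact ⟨1, one_pos, fun z hz _ => hz.1⟩
    · have hlt : P.c (k - 1) < y := lt_of_le_of_ne hyk.1 fun h =>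
        hy.2 ⟨k - 1, by omega, by omega, h.symm⟩
      refine ⟨y - P.c (k - 1), sub_pos.2 hlt, fun z _ h => ?_⟩
      linarith [(abs_lt.1 h).1]
  have hr : ∃ δ > 0, ∀ z ∈ P.X, |z - y| < δ → z ≤ P.c k := by
    by_cases hkN : k = P.N
    · subst hkN
      exact ⟨1, one_pos, fun z hz _ => hz.2⟩
    · have hlt : y < P.c k := lt_of_le_of_ne hyk.2 fun h => hy.2 ⟨k, h1, by omega, h⟩
      refine ⟨P.c k - y, sub_pos.2 hlt, fun z _ h => ?_⟩
      linarith [(abs_lt.1 h).2]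
  obtain ⟨δ₁, hδ₁, hl⟩ := hl
  obtain ⟨δ₂, hδ₂, hr⟩ := hr
  refine ⟨min ε (min δ₁ δ₂), by positivity, fun z hz h => ?_⟩
  simp only [lt_min_iff] at h
  have hzk : z ∈ Icc (P.c (k - 1)) (P.c k) := ⟨hl z hz.1 h.2.1, hr z hz.1 h.2.2⟩
  rw [P.f_eq_fe h1 hk hz.2 hzk, P.f_eq_fe h1 hk hy.2 hyk]
  have := P.hfe_lip k h1 hk z hzk y hyk
  nlinarith [P.hlam.1, P.hlam.2, abs_nonneg (z - y)]

theorem mem_omega_iff {x y : ℝ} :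
    y ∈ P.omega x ↔ ∀ ε > 0, ∃ᶠ n in atTop, |P.f^[n] x - y| < ε := by
  constructor
  · rintro ⟨φ, hφ, hlim⟩ ε hε
    refine hφ.tendsto_atTop.frequently (Eventually.frequently ?_)
    exact (Metric.tendsto_nhds.1 hlim ε hε)
  · intro h
    have : MapClusterPt y atTop fun n => P.f^[n] x := by
      rw [mapClusterPt_iff_frequently]
      intro s hs
      obtain ⟨ε, hε, hs⟩ := Metric.mem_nhds_iff.1 hs
      exact (h ε hε).mono fun n hn => hs hn
    exact this.tendsto_subseq

theorem mem_omega_of_approx {x y : ℝ} (h : ∀ ε > 0, ∃ z ∈ P.omega x, |z - y| < ε) :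
    y ∈ P.omega x := by
  rw [mem_omega_iff]
  intro ε hε
  obtain ⟨z, hz, hzy⟩ := h (ε / 2) (half_pos hε)
  refine (P.mem_omega_iff.1 hz (ε / 2) (half_pos hε)).mono fun n hn => ?_
  have := abs_sub_le (P.f^[n] x) z y
  linarith

theorem f_mem_omega {x y : ℝ} (hx : x ∈ P.Xt) (hy : y ∈ P.X \ P.Δ) (h : y ∈ P.omega x) :
    P.f y ∈ P.omega x := by
  rw [mem_omega_iff] at h ⊢
  intro ε hε
  obtain ⟨δ, hδ, H⟩ := P.f_continuous_off_Δ hy hε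
  refine (tendsto_add_atTop_nat 1).frequently ((h δ hδ).mono fun n hn => ?_)
  rw [Function.iterate_succ_apply']
  exact H _ (hx n) hn

theorem iterate_mem_omega {x y : ℝ} (hx : x ∈ P.Xt) (hy : y ∈ P.Xt) (h : y ∈ P.omega x) (n : ℕ) :
    P.f^[n] y ∈ P.omega x := by
  induction n with
  | zero => exact h
  | succ n ih =>
    rw [Function.iterate_succ_apply']
    exact P.f_mem_omega hx (hy n) ih

theorem omega_subset {x y : ℝ} (hx : x ∈ P.Xt) (hy : y ∈ P.Xt) (h : y ∈ P.omega x) :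
    P.omega y ⊆ P.omega x := fun z hz => P.mem_omega_of_approx fun ε hε => by
  obtain ⟨n, hn⟩ := (P.mem_omega_iff.1 hz ε hε).exists
  exact ⟨_, P.iterate_mem_omega hx hy h n, hn⟩

theorem dplus_mem_omega_of_lrVisited {x : ℝ} (hx : x ∈ P.Xt) {i : ℕ} (h : P.lrVisited x i) :
    P.dplus i ∈ P.omega x := by
  obtain ⟨h1, hN, _, r, _, hr, _, hrp, _, hlim⟩ := h
  rw [mem_omega_iff]
  intro ε hε
  refine (tendsto_add_atTop_nat 1).frequently (hr.tendsto_atTop.frequently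
    (Eventually.frequently ?_))
  filter_upwards [Metric.tendsto_nhds.1 hlim ε hε] with n hn
  rw [Real.dist_eq] at hn
  have hmem := P.piece_subset_Icc (by omega) (by omega) (hrp n)
  have hci : P.c i ∈ Icc (P.c (i + 1 - 1)) (P.c (i + 1)) :=
    ⟨le_rfl, P.c_mono (by omega) (by omega)⟩
  rw [Function.iterate_succ_apply', P.f_eq_fe (by omega) (by omega) (hx (r n)).2 hmem]
  have := P.hfe_lip (i + 1) (by omega) (by omega) _ hmem _ hci
  unfold dplus
  nlinarith [P.hlam.1, P.hlam.2, abs_nonneg (P.f^[r n] x - P.c i)]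

theorem dplus_mem_omega_of_approx {x : ℝ} (hx : x ∈ P.Xt) {i : ℕ} (hN : i < P.N)
    (h : ∀ ε > 0, ∃ y ∈ P.omega x, P.c i < y ∧ y < P.c i + ε) : P.dplus i ∈ P.omega x := by
  refine P.mem_omega_of_approx fun ε hε => ?_
  have hlt : P.c i < P.c (i + 1) := P.c_lt (by omega) (by omega)
  obtain ⟨y, hy, hly, hyr⟩ := h (min ε (P.c (i + 1) - P.c i)) (lt_min hε (sub_pos.2 hlt))
  have hy1 : y < P.c i + ε := hyr.trans_le (by gcongr; exact min_le_left _ _)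
  have hy2 : y < P.c (i + 1) := by linarith [min_le_right ε (P.c (i + 1) - P.c i)]
  have hyk : y ∈ Icc (P.c (i + 1 - 1)) (P.c (i + 1)) := ⟨hly.le, hy2.le⟩
  have hyΔ : y ∉ P.Δ := P.notMem_Δ_of_mem_Ioo (k := i + 1) (by omega) ⟨hly, hy2⟩
  refine ⟨P.f y, P.f_mem_omega hx ⟨P.Icc_subset_X (by omega) hyk, hyΔ⟩ hy, ?_⟩
  rw [P.f_eq_fe (by omega) (by omega) hyΔ hyk]
  have := P.hfe_lip (i + 1) (by omega) (by omega) _ hyk (P.c i) ⟨le_rfl, hlt.le⟩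
  rw [abs_of_pos (sub_pos.2 hly)] at this
  unfold dplus
  nlinarith [P.hlam.1, P.hlam.2]

theorem dminus_mem_omega_of_approx {x : ℝ} (hx : x ∈ P.Xt) {i : ℕ} (h1 : 1 ≤ i) (hN : i < P.N)
    (h : ∀ ε > 0, ∃ y ∈ P.omega x, P.c i - ε < y ∧ y < P.c i) : P.dminus i ∈ P.omega x := by
  refine P.mem_omega_of_approx fun ε hε => ?_
  have hlt : P.c (i - 1) < P.c i := P.c_lt (by omega) (by omega)
  obtain ⟨y, hy, hly, hyr⟩ := h (min ε (P.c i - P.c (i - 1))) (lt_min hε (sub_pos.2 hlt))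
  have hy1 : P.c i - ε < y := by linarith [min_le_left ε (P.c i - P.c (i - 1))]
  have hy2 : P.c (i - 1) < y := by linarith [min_le_right ε (P.c i - P.c (i - 1))]
  have hyk : y ∈ Icc (P.c (i - 1)) (P.c i) := ⟨hy2.le, hyr.le⟩
  have hyΔ : y ∉ P.Δ := P.notMem_Δ_of_mem_Ioo hN.le ⟨hy2, hyr⟩
  refine ⟨P.f y, P.f_mem_omega hx ⟨P.Icc_subset_X hN.le hyk, hyΔ⟩ hy, ?_⟩
  rw [P.f_eq_fe h1 hN.le hyΔ hyk]
  have := P.hfe_lip i h1 hN.le _ hyk (P.c i) ⟨hlt.le, le_rfl⟩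
  rw [abs_sub_comm y, abs_of_pos (sub_pos.2 hyr)] at this
  unfold dminus
  nlinarith [P.hlam.1, P.hlam.2]

/-- Short intervals with endpoints in `ω(x)` only contain, in their interior, boundary points
both of whose lateral limits lie in `ω(x)`. -/
theorem exists_scale_lateral_mem_omega {x : ℝ} (hx : x ∈ P.Xt) :
    ∃ ε > 0, ∀ m, 1 ≤ m → m < P.N → ∀ a ∈ P.omega x, ∀ b ∈ P.omega x,
      a < P.c m → P.c m < b → b - a < ε → P.dplus m ∈ P.omega x ∧ P.dminus m ∈ P.omega x := by
  have key : ∀ m ∈ Finset.Ico 1 P.N, ∀ᶠ ε in 𝓝[>] (0 : ℝ), ∀ a ∈ P.omega x, ∀ b ∈ P.omega x,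
      a < P.c m → P.c m < b → b - a < ε →
        P.dplus m ∈ P.omega x ∧ P.dminus m ∈ P.omega x := by
    intro m hm
    obtain ⟨h1, hN⟩ := Finset.mem_Ico.1 hm
    by_cases hp : P.dplus m ∈ P.omega x
    · by_cases hq : P.dminus m ∈ P.omega x
      · exact Eventually.of_forall fun ε a _ b _ _ _ _ => ⟨hp, hq⟩
      · have := mt (P.dminus_mem_omega_of_approx hx h1 hN) hq
        push Not at this
        obtain ⟨δ, hδ, H⟩ := this
        filter_upwards [Ioo_mem_nhdsGT hδ] with ε hε a ha b _ ham hmb hab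
        linarith [H a ha (by linarith [hε.2])]
    · have := mt (P.dplus_mem_omega_of_approx hx hN) hp
      push Not at this
      obtain ⟨δ, hδ, H⟩ := this
      filter_upwards [Ioo_mem_nhdsGT hδ] with ε hε a _ b hb ham hmb hab
      linarith [H b hb hmb, hε.2]
  obtain ⟨ε, h, hε⟩ := (((eventually_all_finset _).2 key).and self_mem_nhdsWithin).exists
  exact ⟨ε, hε, fun m h1 hN => h m (Finset.mem_Ico.2 ⟨h1, hN⟩)⟩

theorem fe_mem_uIcc (hinj : P.InjPieces) {k : ℕ} (h1 : 1 ≤ k) (hk : k ≤ P.N) {u v y : ℝ}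
    (hu : P.c (k - 1) ≤ u) (huy : u ≤ y) (hyv : y ≤ v) (hv : v ≤ P.c k) :
    P.fe k y ∈ uIcc (P.fe k u) (P.fe k v) := by
  have hlt : P.c (k - 1) < P.c k := P.c_lt (by omega) hk
  have hcont : ContinuousOn (P.fe k) (Icc (P.c (k - 1)) (P.c k)) := by
    have : LipschitzOnWith ⟨P.lam, P.hlam.1.le⟩ (P.fe k) (Icc (P.c (k - 1)) (P.c k)) :=
      LipschitzOnWith.of_dist_le_mul fun a ha b hb => P.hfe_lip k h1 hk a ha b hb
    exact this.continuousOn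
  have hinjk : InjOn (P.fe k) (Ioo (P.c (k - 1)) (P.c k)) := by
    intro a ha b hb hab
    rw [P.hfe_eq k h1 hk a ha, P.hfe_eq k h1 hk b hb] at hab
    exact hinj k h1 hk (Or.inl (Or.inl ha)) (Or.inl (Or.inl hb)) hab
  have hum : u ∈ Icc (P.c (k - 1)) (P.c k) := ⟨hu, by linarith⟩
  have hym : y ∈ Icc (P.c (k - 1)) (P.c k) := ⟨by linarith, by linarith⟩
  have hvm : v ∈ Icc (P.c (k - 1)) (P.c k) := ⟨by linarith, hv⟩
  rcases (hcont.mono Ioo_subset_Icc_self).strictMonoOn_of_injOn_Ioo hlt hinjk with h | h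
  · have H := h.monotoneOn.Icc_of_Ioo hlt hcont
    exact Icc_subset_uIcc ⟨H hum hym huy, H hym hvm hyv⟩
  · have H := MonotoneOn.Icc_of_Ioo hlt h.antitoneOn.neg hcont.neg
    exact Icc_subset_uIcc' ⟨neg_le_neg_iff.1 (H hym hvm hyv), neg_le_neg_iff.1 (H hum hym huy)⟩

theorem dplus_mem_Xt (hD : P.D ⊆ P.Xt) {i : ℕ} (h1 : 1 ≤ i) (hN : i < P.N) : P.dplus i ∈ P.Xt :=
  hD (Or.inl (Or.inr ⟨i, h1, hN, rfl⟩))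

theorem dminus_mem_Xt (hD : P.D ⊆ P.Xt) {i : ℕ} (h1 : 1 ≤ i) (hN : i < P.N) :
    P.dminus i ∈ P.Xt :=
  hD (Or.inl (Or.inl ⟨i, h1, hN, rfl⟩))

/-- If `y` is enclosed by a short interval with endpoints in `ω(d) ∩ X̃`, then so is `f y`, with
the length of the interval reduced by the factor `lam`. -/
theorem enclosure_step (hinj : P.InjPieces) (hD : P.D ⊆ P.Xt) {d ε : ℝ} (hd : d ∈ P.Xt)
    (hε : ∀ m, 1 ≤ m → m < P.N → ∀ a ∈ P.omega d, ∀ b ∈ P.omega d,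
      a < P.c m → P.c m < b → b - a < ε → P.dplus m ∈ P.omega d ∧ P.dminus m ∈ P.omega d)
    {a b y : ℝ} (ha : a ∈ P.omega d ∩ P.Xt) (hb : b ∈ P.omega d ∩ P.Xt) (hy : y ∈ P.X \ P.Δ)
    (hay : a ≤ y) (hyb : y ≤ b) (hab : b - a < ε) :
    ∃ a' ∈ P.omega d ∩ P.Xt, ∃ b' ∈ P.omega d ∩ P.Xt,
      a' ≤ P.f y ∧ P.f y ≤ b' ∧ b' - a' ≤ P.lam * (b - a) := by
  obtain ⟨k, h1, hk, hyk⟩ := P.exists_mem_Icc hy.1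
  have hf : ∀ z ∈ P.omega d ∩ P.Xt, P.f z ∈ P.omega d ∩ P.Xt := fun z hz =>
    ⟨P.f_mem_omega hd (P.Xt_sub hz.2) hz.1, P.iterate_mem_Xt hz.2 1⟩
  have hL : ∃ u, a ≤ u ∧ P.c (k - 1) ≤ u ∧ u ≤ y ∧ P.fe k u ∈ P.omega d ∩ P.Xt := by
    rcases le_or_gt (P.c (k - 1)) a with h | h
    · refine ⟨a, le_rfl, h, hay, ?_⟩
      rw [← P.f_eq_fe h1 hk (P.Xt_sub ha.2).2 ⟨h, hay.trans hyk.2⟩]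
      exact hf a ha
    · have hk1 : k ≠ 1 := by
        rintro rfl
        exact absurd (P.Xt_sub ha.2).1.1 (not_le.2 h)
      have hlt : P.c (k - 1) < y := lt_of_le_of_ne hyk.1 fun h =>
        hy.2 ⟨k - 1, by omega, by omega, h.symm⟩
      have hd' := (hε (k - 1) (by omega) (by omega) a ha.1 b hb.1 h (by linarith) hab).1
      have hX := P.dplus_mem_Xt hD (i := k - 1) (by omega) (by omega)
      refine ⟨P.c (k - 1), h.le, le_rfl, hyk.1, ?_⟩
      unfold dplus at hd' hX
      rw [Nat.sub_add_cancel h1] at hd' hX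
      exact ⟨hd', hX⟩
  have hR : ∃ v, v ≤ b ∧ v ≤ P.c k ∧ y ≤ v ∧ P.fe k v ∈ P.omega d ∩ P.Xt := by
    rcases le_or_gt b (P.c k) with h | h
    · refine ⟨b, le_rfl, h, hyb, ?_⟩
      rw [← P.f_eq_fe h1 hk (P.Xt_sub hb.2).2 ⟨hyk.1.trans hyb, h⟩]
      exact hf b hb
    · have hkN : k < P.N := by
        refine lt_of_le_of_ne hk ?_
        rintro rfl
        exact absurd (P.Xt_sub hb.2).1.2 (not_le.2 h)
      have hlt : y < P.c k := lt_of_le_of_ne hyk.2 fun h => hy.2 ⟨k, h1, hkN, h⟩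
      exact ⟨P.c k, h.le, le_rfl, hyk.2,
        (hε k h1 hkN a ha.1 b hb.1 (by linarith) h hab).2, P.dminus_mem_Xt hD h1 hkN⟩
  obtain ⟨u, hau, hcu, huy, hu⟩ := hL
  obtain ⟨v, hvb, hvc, hyv, hv⟩ := hR
  have hmem := P.fe_mem_uIcc hinj h1 hk hcu huy hyv hvc
  have hlip := P.hfe_lip k h1 hk u ⟨hcu, by linarith⟩ v ⟨by linarith, hvc⟩
  have hlam : P.lam * |u - v| ≤ P.lam * (b - a) := by
    refine mul_le_mul_of_nonneg_left ?_ P.hlam.1.le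
    rw [abs_sub_comm, abs_of_nonneg (by linarith)]
    linarith
  have hlen := abs_le.1 (hlip.trans hlam)
  rw [P.f_eq_fe h1 hk hy.2 hyk]
  rcases mem_uIcc.1 hmem with h | h
  · exact ⟨_, hu, _, hv, h.1, h.2, by linarith⟩
  · exact ⟨_, hv, _, hu, h.1, h.2, by linarith⟩

theorem enclosure_iterate (hinj : P.InjPieces) (hD : P.D ⊆ P.Xt) {d ε : ℝ} (hd : d ∈ P.Xt)
    (hε : ∀ m, 1 ≤ m → m < P.N → ∀ a ∈ P.omega d, ∀ b ∈ P.omega d,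
      a < P.c m → P.c m < b → b - a < ε → P.dplus m ∈ P.omega d ∧ P.dminus m ∈ P.omega d)
    {a b y : ℝ} (ha : a ∈ P.omega d ∩ P.Xt) (hb : b ∈ P.omega d ∩ P.Xt) (hy : y ∈ P.Xt)
    (hay : a ≤ y) (hyb : y ≤ b) (hab : b - a < ε) (n : ℕ) :
    ∃ a' ∈ P.omega d ∩ P.Xt, ∃ b' ∈ P.omega d ∩ P.Xt,
      a' ≤ P.f^[n] y ∧ P.f^[n] y ≤ b' ∧ b' - a' ≤ P.lam ^ n * (b - a) := by
  induction n with
  | zero => exact ⟨a, ha, b, hb, hay, hyb, by simp⟩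
  | succ n ih =>
    obtain ⟨a', ha', b', hb', h1, h2, h3⟩ := ih
    have hpow : P.lam ^ n ≤ 1 := pow_le_one₀ P.hlam.1.le P.hlam.2.le
    have hlt : b' - a' < ε := by nlinarith
    obtain ⟨a'', ha'', b'', hb'', h1', h2', h3'⟩ :=
      P.enclosure_step hinj hD hd hε ha' hb' (hy n) h1 h2 hlt
    rw [Function.iterate_succ_apply']
    refine ⟨a'', ha'', b'', hb'', h1', h2', h3'.trans ?_⟩
    rw [pow_succ', mul_assoc]
    exact mul_le_mul_of_nonneg_left h3 P.hlam.1.le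

theorem exists_orbit_straddling {e : ℝ} (he : e ∈ P.Xt) {i : ℕ} (h : P.lrVisited e i) {ε : ℝ}
    (hε : 0 < ε) :
    ∃ p q, P.c i - ε < P.f^[p] e ∧ P.f^[p] e < P.c i ∧
      P.c i < P.f^[q] e ∧ P.f^[q] e < P.c i + ε := by
  obtain ⟨h1, hN, l, r, _, _, hlp, hrp, hl, hr⟩ := h
  obtain ⟨s, hs⟩ := (Metric.tendsto_nhds.1 hl ε hε).exists
  obtain ⟨t, ht⟩ := (Metric.tendsto_nhds.1 hr ε hε).exists
  rw [Real.dist_eq, abs_lt] at hs ht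
  have hne : ∀ n, P.f^[n] e ≠ P.c i := fun n h => (he n).2 ⟨i, h1, hN, h⟩
  refine ⟨l s, r t, by linarith, ?_, ?_, by linarith⟩
  · exact lt_of_le_of_ne (P.piece_subset_Icc h1 hN.le (hlp s)).2 (hne _)
  · exact lt_of_le_of_ne (P.piece_subset_Icc (by omega) hN (hrp t)).1 (hne _).symm

/-- If orbits in `ω(d)` straddle `c i` at every scale and the orbit of `x` accumulates on `c i`,
then `ω(x) ⊆ ω(d)`. -/
theorem omega_subset_of_lrVisited (hinj : P.InjPieces) (hD : P.D ⊆ P.Xt) {x d e : ℝ}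
    (hx : x ∈ P.Xt) (hd : d ∈ P.Xt) (he : e ∈ P.Xt) (hed : e ∈ P.omega d) {i : ℕ}
    (hei : P.lrVisited e i) (hxi : P.lrVisited x i) : P.omega x ⊆ P.omega d := by
  obtain ⟨ε, hε, H⟩ := P.exists_scale_lateral_mem_omega hd
  obtain ⟨p, q, hp, hpc, hcq, hq⟩ := P.exists_orbit_straddling he hei (half_pos hε)
  have hS : ∀ n, P.f^[n] e ∈ P.omega d ∩ P.Xt := fun n =>
    ⟨P.iterate_mem_omega hd he hed n, P.iterate_mem_Xt he n⟩
  have hδ : 0 < min (P.c i - P.f^[p] e) (P.f^[q] e - P.c i) :=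
    lt_min (sub_pos.2 hpc) (sub_pos.2 hcq)
  obtain ⟨s, _, hs, hsc, _, _⟩ := P.exists_orbit_straddling hx hxi hδ
  have hps : P.f^[p] e ≤ P.f^[s] x := by
    linarith [min_le_left (P.c i - P.f^[p] e) (P.f^[q] e - P.c i)]
  intro z hz
  refine P.mem_omega_of_approx fun η hη => ?_
  have hpow : Tendsto (fun n : ℕ => P.lam ^ n * (P.f^[q] e - P.f^[p] e)) atTop (𝓝 0) := by
    simpa using (tendsto_pow_atTop_nhds_zero_of_lt_one P.hlam.1.le P.hlam.2).mul_const
      (P.f^[q] e - P.f^[p] e)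
  have hev : ∀ᶠ n : ℕ in atTop,
      P.lam ^ (n - s) * (P.f^[q] e - P.f^[p] e) < η / 2 :=
    (tendsto_sub_atTop_nat s).eventually (hpow.eventually_lt_const (half_pos hη))
  obtain ⟨n, hn, hlt, hsn⟩ := ((P.mem_omega_iff.1 hz (η / 2) (half_pos hη)).and_eventually
    (hev.and (eventually_ge_atTop s))).exists
  obtain ⟨a, ha, b, _, h1, h2, h3⟩ := P.enclosure_iterate hinj hD hd H (hS p) (hS q)
    (P.iterate_mem_Xt hx s) hps (by linarith) (by linarith) (n - s)
  rw [← Function.iterate_add_apply, Nat.sub_add_cancel hsn] at h1 h2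
  refine ⟨a, ha.1, ?_⟩
  rw [abs_lt] at hn ⊢
  constructor <;> linarith

end PCIM

/-- If `f` is injective on each piece, `D ⊆ X̃`, `x ∈ X̃`, and
`c_i ∈ Δ_lr(d_j^+) ∩ Δ_lr(x)`, `c_j ∈ Δ_lr(d_i^+) ∩ Δ_lr(x)`, then
`ω(x) = ω(d_i^+) = ω(d_j^+)`. -/
theorem stmt17 (P : PCIM) (hinj : P.InjPieces) (hD : P.D ⊆ P.Xt)
    (x : ℝ) (hx : x ∈ P.Xt) (i j : ℕ)
    (h1 : P.lrVisited (P.dplus j) i) (h2 : P.lrVisited x i)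
    (h3 : P.lrVisited (P.dplus i) j) (h4 : P.lrVisited x j) :
    P.omega x = P.omega (P.dplus i) ∧ P.omega x = P.omega (P.dplus j) := by
  obtain ⟨hi, hiN, _⟩ := id h1
  obtain ⟨hj, hjN, _⟩ := id h3
  have hdi := P.dplus_mem_Xt hD hi hiN
  have hdj := P.dplus_mem_Xt hD hj hjN
  exact ⟨Subset.antisymm
      (P.omega_subset_of_lrVisited hinj hD hx hdi hdj (P.dplus_mem_omega_of_lrVisited hdi h3) h1 h2)
      (P.omega_subset hx hdi (P.dplus_mem_omega_of_lrVisited hx h2)),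
    Subset.antisymm
      (P.omega_subset_of_lrVisited hinj hD hx hdj hdi (P.dplus_mem_omega_of_lrVisited hdj h1) h3 h4)
      (P.omega_subset hx hdj (P.dplus_mem_omega_of_lrVisited hx h4))⟩
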